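/- arXiv:1211.4640 — 2 statements merged into one kernel-verified Lean document; each statement's English description precedes it below -/
import Mathlib

section
/- For every pair of real numbers s, t, the joint characteristic function φₙ(s,t) = ∫₀¹ exp(i·(s·μₙ(θ) + t·νₙ(θ))) dθ converges, as n → ∞, to e^{−(s²+t²)/4}. (Two-dimensional Salem–Zygmund central limit theorem for the sequence k_j = 8^j: the pair (μₙ, νₙ) converges in distribution to a centered Gaussian vector with covariance matrix diag(1/2, 1/2).) -/
open MeasureTheory Filter
open scoped Real Topology

/-- `μₙ(θ) = (1/√n)·Σ_{j=1}^n sin(2π·8^j·θ)`. -/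
noncomputable def lacunarySin (n : ℕ) (θ : ℝ) : ℝ :=
  (∑ j ∈ Finset.Icc 1 n, Real.sin (2 * π * 8 ^ j * θ)) / Real.sqrt n

/-- `νₙ(θ) = (1/√n)·Σ_{j=1}^n cos(2π·8^j·θ)`. -/
noncomputable def lacunaryCos (n : ℕ) (θ : ℝ) : ℝ :=
  (∑ j ∈ Finset.Icc 1 n, Real.cos (2 * π * 8 ^ j * θ)) / Real.sqrt n

/-- The joint characteristic function `φₙ(s,t)`. -/
noncomputable def lacunaryCharFun (n : ℕ) (s t : ℝ) : ℂ :=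
  ∫ θ in (0:ℝ)..1,
    Complex.exp (Complex.I * (s * lacunarySin n θ + t * lacunaryCos n θ))

lemma sz_shift_zero {E : Type*} [NormedAddCommGroup E] [NormedSpace ℝ E] (u : ℝ → E) (c : ℝ)
    (hp : ∀ θ, u (θ + 1) = u θ) (hc : ∀ θ, u (θ + c) = -u θ) :
    ∫ θ in (0:ℝ)..1, u θ = 0 := by
  have hper : Function.Periodic u 1 := hp
  have h1 : ∫ θ in (0:ℝ)..1, u (θ + c) = ∫ θ in (0:ℝ)..1, u θ := by
    rw [intervalIntegral.integral_comp_add_right u c]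
    have := hper.intervalIntegral_add_eq c 0
    simpa [add_comm] using this
  simp only [hc, intervalIntegral.integral_neg] at h1
  have h2 : (2:ℝ) • ∫ θ in (0:ℝ)..1, u θ = 0 := by
    rw [two_smul]
    nth_rewrite 1 [← h1]
    simp
  simpa using h2

/-- Product integral is one. -/
lemma sz_prod_int (n : ℕ) : ∀ (a : ℕ → ℝ → ℝ) (h : ℕ → ℝ), (∀ j, Continuous (a j)) →
    (∀ j θ, a j (θ + 1) = a j θ) → (∀ j θ, a j (θ + h j) = -a j θ) →
    (∀ j l θ, j < l → a l (θ + h j) = a l θ) →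
    ∫ θ in (0:ℝ)..1, ∏ j ∈ Finset.range n, (1 + Complex.I * (a j θ : ℂ)) = 1 := by
  induction n with
  | zero => intro a h _ _ _ _; simp
  | succ n ih =>
    intro a h hcont hp hs hl
    have hc' : Continuous fun θ => ∏ j ∈ Finset.range n, (1 + Complex.I * (a (j+1) θ : ℂ)) := by
      refine continuous_finsetProd _ fun j _ => ?_
      have := hcont (j+1)
      fun_prop
    have e : ∀ θ, ∏ j ∈ Finset.range (n+1), (1 + Complex.I * (a j θ : ℂ)) =
        (∏ j ∈ Finset.range n, (1 + Complex.I * (a (j+1) θ : ℂ))) +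
        (∏ j ∈ Finset.range n, (1 + Complex.I * (a (j+1) θ : ℂ))) * (Complex.I * (a 0 θ : ℂ)) := by
      intro θ
      rw [Finset.prod_range_succ']
      ring
    simp only [e]
    have h0 := hcont 0
    rw [intervalIntegral.integral_add (hc'.intervalIntegrable _ _)
      (Continuous.intervalIntegrable (by fun_prop) _ _)]
    rw [ih (fun j => a (j+1)) (fun j => h (j+1)) (fun j => hcont _) (fun j => hp _)
      (fun j => hs _) (fun j l θ hjl => hl _ _ _ (by omega))]
    rw [sz_shift_zero _ (h 0)]
    · simp
    · intro θ; simp only [hp]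
    · intro θ
      have : ∀ j, a (j+1) (θ + h 0) = a (j+1) θ := fun j => hl _ _ _ (by omega)
      simp only [this, hs]
      push_cast; ring

lemma sz_sum_int (n : ℕ) (M : ℝ) : ∀ (a : ℕ → ℝ → ℝ) (h : ℕ → ℝ), (∀ j, Continuous (a j)) →
    (∀ j θ, a j (θ + 1) = a j θ) → (∀ j θ, a j (θ + h j) = -a j θ) →
    (∀ j l θ, j < l → a l (θ + h j) = a l θ) → (∀ j θ, (a j θ)^2 ≤ M) →
    ∫ θ in (0:ℝ)..1, (∑ j ∈ Finset.range n, a j θ)^2 ≤ n * M := by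
  induction n with
  | zero => intro a h _ _ _ _ _; simp
  | succ n ih =>
    intro a h hcont hp hs hl hM
    have hc' : Continuous fun θ => ∑ j ∈ Finset.range n, a (j+1) θ :=
      continuous_finsetSum _ fun j _ => hcont (j+1)
    have h0 := hcont 0
    have e : ∀ θ, (∑ j ∈ Finset.range (n+1), a j θ)^2 =
        (∑ j ∈ Finset.range n, a (j+1) θ)^2 + ((2 * ∑ j ∈ Finset.range n, a (j+1) θ) * a 0 θ +
          (a 0 θ)^2) := by
      intro θ
      rw [Finset.sum_range_succ']
      ring
    simp only [e]
    rw [intervalIntegral.integral_add (Continuous.intervalIntegrable (by fun_prop) _ _)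
      (Continuous.intervalIntegrable (by fun_prop) _ _),
      intervalIntegral.integral_add (Continuous.intervalIntegrable (by fun_prop) _ _)
      (Continuous.intervalIntegrable (by fun_prop) _ _)]
    have h1 := ih (fun j => a (j+1)) (fun j => h (j+1)) (fun j => hcont _) (fun j => hp _)
      (fun j => hs _) (fun j l θ hjl => hl _ _ _ (by omega)) (fun j => hM _)
    have h2 : ∫ θ in (0:ℝ)..1, (2 * ∑ j ∈ Finset.range n, a (j+1) θ) * a 0 θ = 0 := by
      apply sz_shift_zero _ (h 0)
      · intro θ; simp only [hp]
      · intro θ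
        have : ∀ j, a (j+1) (θ + h 0) = a (j+1) θ := fun j => hl _ _ _ (by omega)
        simp only [this, hs]
        ring
    have h3 : ∫ θ in (0:ℝ)..1, (a 0 θ)^2 ≤ ∫ θ in (0:ℝ)..1, M :=
      intervalIntegral.integral_mono_on (by norm_num)
        (Continuous.intervalIntegrable (by fun_prop) _ _)
        (Continuous.intervalIntegrable (by fun_prop) _ _) (fun θ _ => hM 0 θ)
    simp only [intervalIntegral.integral_const, sub_zero, one_smul] at h3
    rw [h2]
    push_cast
    linarith

lemma sz_norm_one_add (x : ℝ) : ‖1 + Complex.I * (x:ℂ)‖ ≤ Real.exp (x^2/2) := by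
  have h : ‖1 + Complex.I * (x:ℂ)‖ ^ 2 = 1 + x^2 := by
    rw [← Complex.normSq_eq_norm_sq, Complex.normSq_apply]
    simp; ring
  have h2 : Real.exp (x^2/2) ^ 2 = Real.exp (x^2) := by
    rw [← Real.exp_nat_mul]; congr 1; push_cast; ring
  apply le_of_sq_le_sq _ (Real.exp_pos _).le
  rw [h, h2]
  linarith [Real.add_one_le_exp (x^2)]

lemma sz_factor_norm (x : ℝ) :
    ‖(1 + Complex.I * (x:ℂ)) * (Real.exp (-(x^2/2)) : ℂ)‖ ≤ 1 := by
  rw [norm_mul, Complex.norm_real, Real.norm_of_nonneg (Real.exp_pos _).le]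
  calc _ ≤ Real.exp (x^2/2) * Real.exp (-(x^2/2)) := by
        gcongr; exact sz_norm_one_add x
    _ = 1 := by rw [← Real.exp_add]; simp

lemma sz_factor_diff (x : ℝ) (hx : |x| ≤ 1) :
    ‖Complex.exp (Complex.I * (x:ℂ)) - (1 + Complex.I * (x:ℂ)) * (Real.exp (-(x^2/2)) : ℂ)‖
      ≤ 2 * |x|^3 := by
  have hn : ‖Complex.I * (x:ℂ)‖ = |x| := by simp
  have h1 := Complex.exp_bound (x := Complex.I * (x:ℂ)) (by rw [hn]; exact hx) (n := 3) (by norm_num)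
  rw [hn] at h1
  have hx2 : x^2 ≤ 1 := by rw [← sq_abs]; nlinarith [abs_nonneg x]
  have h2 : |Real.exp (-(x^2/2)) - 1 - (-(x^2/2))| ≤ (-(x^2/2))^2 :=
    Real.abs_exp_sub_one_sub_id_le (by rw [abs_neg, abs_of_nonneg (by positivity)]; linarith)
  set r : ℝ := Real.exp (-(x^2/2)) - 1 - (-(x^2/2)) with hr
  have hE : Real.exp (-(x^2/2)) = 1 - x^2/2 + r := by rw [hr]; ring
  have hsum : ∑ m ∈ Finset.range 3, (Complex.I * (x:ℂ))^m / (m.factorial : ℂ)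
      = 1 + Complex.I * x - (x:ℂ)^2/2 := by
    simp [Finset.sum_range_succ, mul_pow, Nat.factorial]; ring
  rw [hsum] at h1
  have key : Complex.exp (Complex.I * (x:ℂ)) - (1 + Complex.I * (x:ℂ)) * (Real.exp (-(x^2/2)) : ℂ)
      = (Complex.exp (Complex.I * (x:ℂ)) - (1 + Complex.I * x - (x:ℂ)^2/2))
        + (Complex.I * ((x^3/2 : ℝ) : ℂ) - (1 + Complex.I * (x:ℂ)) * (r:ℂ)) := by
    rw [hE]; push_cast; ring
  rw [key]
  have h3 : ‖1 + Complex.I * (x:ℂ)‖ ≤ 2 := by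
    refine (norm_add_le _ _).trans ?_
    rw [hn]; simp; linarith
  have h4 : ‖Complex.I * ((x^3/2 : ℝ) : ℂ)‖ = |x|^3/2 := by
    rw [norm_mul, Complex.norm_I, Complex.norm_real, Real.norm_eq_abs, abs_div, abs_pow]; simp
  have h5 : ‖(1 + Complex.I * (x:ℂ)) * (r:ℂ)‖ ≤ 2 * (|x|^3/4) := by
    rw [norm_mul, Complex.norm_real, Real.norm_eq_abs]
    have : |r| ≤ |x|^3/4 := by
      refine h2.trans ?_
      have : (-(x^2/2))^2 = |x|^3 * |x| / 4 := by
        rw [← sq_abs x]; ring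
      rw [this]
      have := mul_le_mul_of_nonneg_left hx (pow_nonneg (abs_nonneg x) 3)
      linarith
    gcongr
  have h6 := norm_add_le (Complex.exp (Complex.I * (x:ℂ)) - (1 + Complex.I * x - (x:ℂ)^2/2))
    (Complex.I * ((x^3/2 : ℝ) : ℂ) - (1 + Complex.I * (x:ℂ)) * (r:ℂ))
  have h7 := norm_sub_le (Complex.I * ((x^3/2 : ℝ) : ℂ)) ((1 + Complex.I * (x:ℂ)) * (r:ℂ))
  have h8 : |x|^3 * ((Nat.succ 3 : ℝ) * ((Nat.factorial 3 : ℝ) * (3:ℕ))⁻¹) ≤ |x|^3 := by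
    have : ((Nat.succ 3 : ℝ) * ((Nat.factorial 3 : ℝ) * (3:ℕ))⁻¹) ≤ 1 := by
      norm_num [Nat.factorial]
    exact mul_le_of_le_one_right (by positivity) this
  linarith

lemma sz_prod_diff (f g : ℕ → ℂ) (d : ℝ) (hf : ∀ j, ‖f j‖ ≤ 1) (hg : ∀ j, ‖g j‖ ≤ 1)
    (hd : ∀ j, ‖f j - g j‖ ≤ d) (n : ℕ) :
    ‖∏ j ∈ Finset.range n, f j - ∏ j ∈ Finset.range n, g j‖ ≤ n * d := by
  induction n with
  | zero => simp
  | succ n ih =>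
    rw [Finset.prod_range_succ, Finset.prod_range_succ]
    have hG : ‖∏ j ∈ Finset.range n, g j‖ ≤ 1 := by
      rw [norm_prod]
      exact Finset.prod_le_one (fun _ _ => norm_nonneg _) (fun j _ => hg j)
    have e : (∏ j ∈ Finset.range n, f j) * f n - (∏ j ∈ Finset.range n, g j) * g n
      = (∏ j ∈ Finset.range n, f j - ∏ j ∈ Finset.range n, g j) * f n
        + (∏ j ∈ Finset.range n, g j) * (f n - g n) := by ring
    rw [e]
    refine (norm_add_le _ _).trans ?_
    rw [norm_mul, norm_mul]
    have a1 := mul_le_of_le_one_right (norm_nonneg (∏ j ∈ Finset.range n, f j - ∏ j ∈ Finset.range n, g j)) (hf n)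
    have a2 := mul_le_of_le_one_left (norm_nonneg (f n - g n)) hG
    have a3 := hd n
    push_cast
    linarith

lemma sz_exp_lip (a b : ℝ) (ha : 0 ≤ a) (hb : 0 ≤ b) :
    |Real.exp (-a) - Real.exp (-b)| ≤ |a - b| := by
  wlog h : a ≤ b generalizing a b
  · rw [abs_sub_comm, abs_sub_comm a b]; exact this b a hb ha (by linarith)
  have h1 : Real.exp (-b) ≤ Real.exp (-a) := Real.exp_le_exp.2 (by linarith)
  rw [abs_of_nonneg (by linarith), abs_of_nonpos (by linarith)]
  have h2 : Real.exp (-b) = Real.exp (-a) * Real.exp (a - b) := by rw [← Real.exp_add]; congr 1; ring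
  have h3 := Real.add_one_le_exp (a - b)
  have h4 : Real.exp (-a) ≤ 1 := Real.exp_le_one_iff.2 (by linarith)
  have h5 := Real.exp_pos (-a)
  rw [h2]
  nlinarith

lemma sz_pointwise (n : ℕ) (x : ℕ → ℝ) (c v : ℝ) (hc : c ≤ 1) (hx : ∀ j, |x j| ≤ c)
    (hv : 0 ≤ v) :
    ‖Complex.exp (Complex.I * ((∑ j ∈ Finset.range n, x j : ℝ) : ℂ))
      - (∏ j ∈ Finset.range n, (1 + Complex.I * (x j : ℂ))) * (Real.exp (-v) : ℂ)‖
    ≤ n * (2 * c^3) + Real.exp (n * c^2 / 2) * |(∑ j ∈ Finset.range n, (x j)^2)/2 - v| := by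
  have h1 := sz_prod_diff (fun j => Complex.exp (Complex.I * (x j:ℂ)))
    (fun j => (1 + Complex.I * (x j:ℂ)) * (Real.exp (-((x j)^2/2)) : ℂ)) (2 * c^3)
    (fun j => by rw [mul_comm, Complex.norm_exp_ofReal_mul_I])
    (fun j => sz_factor_norm _)
    (fun j => (sz_factor_diff _ ((hx j).trans hc)).trans (by gcongr; exact hx j)) n
  rw [← Complex.exp_sum, ← Finset.mul_sum, Finset.prod_mul_distrib, ← Complex.ofReal_prod,
    ← Complex.ofReal_sum, ← Real.exp_sum, Finset.sum_neg_distrib, ← Finset.sum_div] at h1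
  set Q := ∑ j ∈ Finset.range n, (x j)^2 with hQ
  set T := ∏ j ∈ Finset.range n, (1 + Complex.I * (x j : ℂ)) with hT
  have hc0 : 0 ≤ c := (abs_nonneg _).trans (hx 0)
  have hQle : Q ≤ n * c^2 := by
    have : Q ≤ ∑ j ∈ Finset.range n, c^2 :=
      Finset.sum_le_sum fun j _ => by rw [← sq_abs]; gcongr; exact hx j
    simpa using this
  have hTn : ‖T‖ ≤ Real.exp (n * c^2/2) := by
    rw [hT, norm_prod]
    calc _ ≤ ∏ j ∈ Finset.range n, Real.exp ((x j)^2/2) :=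
          Finset.prod_le_prod (fun _ _ => norm_nonneg _) (fun j _ => sz_norm_one_add _)
      _ = Real.exp (Q/2) := by rw [← Real.exp_sum, hQ, Finset.sum_div]
      _ ≤ _ := Real.exp_le_exp.2 (by linarith)
  have hQ0 : 0 ≤ Q := Finset.sum_nonneg fun j _ => sq_nonneg _
  have h2 : ‖T * (Real.exp (-(Q/2)) : ℂ) - T * (Real.exp (-v) : ℂ)‖
      ≤ Real.exp (n * c^2 / 2) * |Q/2 - v| := by
    rw [← mul_sub, norm_mul, ← Complex.ofReal_sub, Complex.norm_real, Real.norm_eq_abs]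
    exact mul_le_mul hTn (sz_exp_lip (Q/2) v (by linarith) hv) (abs_nonneg _) (Real.exp_pos _).le
  exact (norm_sub_le_norm_sub_add_norm_sub _ _ _).trans (add_le_add h1 h2)

noncomputable def szA (A B : ℝ) (m : ℕ) (j : ℕ) (θ : ℝ) : ℝ :=
  A * Real.sin (m * (2 * π * 8 ^ (j+1) * θ)) + B * Real.cos (m * (2 * π * 8 ^ (j+1) * θ))

lemma szA_cont (A B : ℝ) (m j : ℕ) : Continuous (szA A B m j) := by
  unfold szA; fun_prop

lemma szA_per (A B : ℝ) (m j : ℕ) (θ : ℝ) : szA A B m j (θ + 1) = szA A B m j θ := by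
  unfold szA
  have : (m : ℝ) * (2 * π * 8 ^ (j+1) * (θ+1)) = m * (2 * π * 8 ^ (j+1) * θ) +
      ((m * 8^(j+1) : ℕ) : ℝ) * (2 * π) := by push_cast; ring
  rw [this, Real.sin_add_nat_mul_two_pi, Real.cos_add_nat_mul_two_pi]

lemma szA_shift (A B : ℝ) (m j : ℕ) (hm : m ≠ 0) (θ : ℝ) :
    szA A B m j (θ + 1 / (2 * m * 8^(j+1))) = - szA A B m j θ := by
  unfold szA
  have : (m : ℝ) * (2 * π * 8 ^ (j+1) * (θ+1 / (2 * m * 8^(j+1)))) =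
      m * (2 * π * 8 ^ (j+1) * θ) + π := by
    have : (m:ℝ) ≠ 0 := by exact_mod_cast hm
    field_simp
  rw [this, Real.sin_add_pi, Real.cos_add_pi]
  ring

lemma szA_shift_lt (A B : ℝ) (m j l : ℕ) (hm : m ≠ 0) (θ : ℝ) (h : j < l) :
    szA A B m l (θ + 1 / (2 * m * 8^(j+1))) = szA A B m l θ := by
  obtain ⟨d, rfl⟩ := Nat.exists_eq_add_of_lt h
  unfold szA
  have : (m : ℝ) * (2 * π * 8 ^ (j+d+1+1) * (θ+1 / (2 * m * 8^(j+1)))) =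
      m * (2 * π * 8 ^ (j+d+1+1) * θ) + ((4 * 8^d : ℕ) : ℝ) * (2 * π) := by
    have : (m:ℝ) ≠ 0 := by exact_mod_cast hm
    have e : (8:ℝ) ^ (j+d+1+1) = 8^(j+1) * (8 * 8^d) := by ring
    rw [e]
    push_cast
    field_simp
    ring
  rw [this, Real.sin_add_nat_mul_two_pi, Real.cos_add_nat_mul_two_pi]

lemma szA_abs (A B : ℝ) (m j : ℕ) (θ : ℝ) : |szA A B m j θ| ≤ |A| + |B| := by
  unfold szA
  refine (abs_add_le _ _).trans ?_
  rw [abs_mul, abs_mul]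
  exact add_le_add (mul_le_of_le_one_right (abs_nonneg _) (Real.abs_sin_le_one _))
    (mul_le_of_le_one_right (abs_nonneg _) (Real.abs_cos_le_one _))

lemma szA_sq (s t : ℝ) (j : ℕ) (θ : ℝ) :
    (szA s t 1 j θ)^2 = (s^2+t^2)/2 + szA (s*t) ((t^2-s^2)/2) 2 j θ := by
  unfold szA
  push_cast
  rw [one_mul, Real.sin_two_mul, Real.cos_two_mul]
  linear_combination s^2 * Real.sin_sq_add_cos_sq (2 * π * 8 ^ (j+1) * θ)

lemma sz_bound (s t : ℝ) (n : ℕ) (hn : 0 < n) (hC : (|s| + |t|) / Real.sqrt n ≤ 1) :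
    ‖lacunaryCharFun n s t - (Real.exp (-((s^2+t^2)/4)) : ℂ)‖ ≤
      (2 * (|s|+|t|)^3 + Real.exp ((|s|+|t|)^2/2) *
        ((1 + (|s*t| + |(t^2-s^2)/2|)^2)/4)) / Real.sqrt n := by
  have hn' : (0:ℝ) < n := by exact_mod_cast hn
  set q := Real.sqrt n with hq
  have hq0 : 0 < q := Real.sqrt_pos.2 hn'
  have hqq : q^2 = n := Real.sq_sqrt hn'.le
  set C := |s| + |t| with hCdef
  set M := |s*t| + |(t^2-s^2)/2| with hMdef
  set v := (s^2+t^2)/4 with hv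
  set W : ℝ → ℝ := fun θ => ∑ j ∈ Finset.range n, szA (s*t) ((t^2-s^2)/2) 2 j θ with hW
  have hWc : Continuous W := continuous_finsetSum _ fun j _ => szA_cont _ _ _ _
  set x : ℕ → ℝ → ℝ := fun j θ => szA (s/q) (t/q) 1 j θ with hxdef
  have hxs : ∀ j θ, x j θ = szA s t 1 j θ / q := by
    intro j θ; simp only [hxdef, szA]; ring
  have hxb : ∀ j θ, |x j θ| ≤ C / q := by
    intro j θ
    rw [hxs, abs_div, abs_of_pos hq0]
    gcongr
    exact szA_abs _ _ _ _ _
  have hQ : ∀ θ, (∑ j ∈ Finset.range n, (x j θ)^2)/2 - v = W θ / (2 * q^2) := by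
    intro θ
    simp only [hxs, div_pow, szA_sq]
    rw [← Finset.sum_div, Finset.sum_add_distrib]
    simp only [Finset.sum_const, Finset.card_range, nsmul_eq_mul, ← hqq, hW, hv]
    field_simp
    ring
  set T : ℝ → ℂ := fun θ => ∏ j ∈ Finset.range n, (1 + Complex.I * (x j θ : ℂ)) with hT
  have hxc : ∀ j, Continuous (x j) := fun j => szA_cont _ _ _ _
  have hTc : Continuous T := by
    refine continuous_finsetProd _ fun j _ => ?_
    have := hxc j
    fun_prop
  have hTint : ∫ θ in (0:ℝ)..1, T θ = 1 :=
    sz_prod_int n x (fun j => 1 / (2 * (1:ℕ) * 8^(j+1))) hxc (fun j θ => szA_per _ _ _ _ _)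
      (fun j θ => szA_shift _ _ _ _ one_ne_zero _)
      (fun j l θ h => szA_shift_lt _ _ _ _ _ one_ne_zero _ h)
  have hWint : ∫ θ in (0:ℝ)..1, (W θ)^2 ≤ n * M^2 :=
    sz_sum_int n (M^2) _ (fun j => 1 / (2 * (2:ℕ) * 8^(j+1))) (fun j => szA_cont _ _ _ _)
      (fun j θ => szA_per _ _ _ _ _)
      (fun j θ => szA_shift _ _ _ _ two_ne_zero _)
      (fun j l θ h => szA_shift_lt _ _ _ _ _ two_ne_zero _ h)
      (fun j θ => by rw [← sq_abs]; gcongr; exact szA_abs _ _ _ _ _)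
  have hphi : lacunaryCharFun n s t =
      ∫ θ in (0:ℝ)..1, Complex.exp (Complex.I * ((∑ j ∈ Finset.range n, x j θ : ℝ) : ℂ)) := by
    unfold lacunaryCharFun
    congr 1
    ext θ
    congr 2
    rw [← Complex.ofReal_mul, ← Complex.ofReal_mul, ← Complex.ofReal_add]
    congr 1
    unfold lacunarySin lacunaryCos
    have hr : ∀ f : ℕ → ℝ, ∑ j ∈ Finset.Icc 1 n, f j = ∑ j ∈ Finset.range n, f (j+1) := by
      intro f
      rw [Finset.range_eq_Ico, Finset.sum_Ico_add' f 0 n 1]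
      rfl
    rw [hr, hr, ← hq, mul_div_assoc', mul_div_assoc', ← add_div, Finset.mul_sum, Finset.mul_sum,
      ← Finset.sum_add_distrib, Finset.sum_div]
    refine Finset.sum_congr rfl fun j _ => ?_
    rw [hxs]
    simp [szA]
  have hEc : Continuous fun θ =>
      Complex.exp (Complex.I * ((∑ j ∈ Finset.range n, x j θ : ℝ) : ℂ)) := by
    have : Continuous fun θ => ∑ j ∈ Finset.range n, x j θ :=
      continuous_finsetSum _ fun j _ => hxc j
    fun_prop
  have hdiff : lacunaryCharFun n s t - (Real.exp (-v) : ℂ) =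
      ∫ θ in (0:ℝ)..1, (Complex.exp (Complex.I * ((∑ j ∈ Finset.range n, x j θ : ℝ) : ℂ))
        - T θ * (Real.exp (-v) : ℂ)) := by
    rw [intervalIntegral.integral_sub (hEc.intervalIntegrable _ _)
      (Continuous.intervalIntegrable (by fun_prop) _ _), intervalIntegral.integral_mul_const,
      hTint, hphi, one_mul]
  rw [hdiff]
  set K := Real.exp (C^2/2) with hK
  have hK0 : 0 < K := Real.exp_pos _
  have hpt : ∀ θ, ‖Complex.exp (Complex.I * ((∑ j ∈ Finset.range n, x j θ : ℝ) : ℂ))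
        - T θ * (Real.exp (-v) : ℂ)‖ ≤ (2*C^3/q + K/(4*q)) + K/(4*q^3) * (W θ)^2 := by
    intro θ
    have h := sz_pointwise n (fun j => x j θ) (C/q) v hC (fun j => hxb j θ)
      (by rw [hv]; positivity)
    refine h.trans ?_
    rw [hQ, ← hqq]
    have e1 : q^2 * (2 * (C/q)^3) = 2*C^3/q := by field_simp
    have e2 : q^2 * (C/q)^2/2 = C^2/2 := by field_simp
    rw [e1, e2, ← hK, abs_div, abs_of_pos (show 0 < 2*q^2 by positivity)]
    have e3 : |W θ| / (2*q^2) ≤ 1/(4*q) + 1/(4*q^3) * (W θ)^2 := by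
      rw [← sq_abs (W θ)]
      have : 1/(4*q) + 1/(4*q^3) * |W θ|^2 - |W θ| / (2*q^2) = (q - |W θ|)^2/(4*q^3) := by
        field_simp; ring
      have : 0 ≤ (q - |W θ|)^2/(4*q^3) := by positivity
      linarith
    have := mul_le_mul_of_nonneg_left e3 hK0.le
    have e4 : K * (1/(4*q) + 1/(4*q^3) * (W θ)^2) = K/(4*q) + K/(4*q^3) * (W θ)^2 := by ring
    linarith
  refine (intervalIntegral.norm_integral_le_of_norm_le (by norm_num)
    (Filter.Eventually.of_forall fun θ _ => hpt θ)
    (Continuous.intervalIntegrable (by fun_prop) _ _)).trans ?_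
  rw [intervalIntegral.integral_add (by simp)
    (Continuous.intervalIntegrable (by fun_prop) _ _), intervalIntegral.integral_const_mul]
  simp only [intervalIntegral.integral_const, sub_zero, one_smul]
  have h1 := mul_le_mul_of_nonneg_left hWint (show 0 ≤ K/(4*q^3) by positivity)
  have h2 : (2*C^3 + K * ((1+M^2)/4))/q = (2*C^3/q + K/(4*q)) + K/(4*q^3) * (n * M^2) := by
    rw [← hqq]; field_simp; ring
  rw [h2]
  linarith

theorem salem_zygmund_clt (s t : ℝ) :
    Tendsto (fun n : ℕ => lacunaryCharFun n s t) atTop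
      (𝓝 (Complex.exp (-((s : ℂ) ^ 2 + (t : ℂ) ^ 2) / 4))) := by
  have hlim : Complex.exp (-((s : ℂ) ^ 2 + (t : ℂ) ^ 2) / 4) =
      (Real.exp (-((s^2+t^2)/4)) : ℂ) := by
    push_cast; congr 1; ring
  rw [hlim, tendsto_iff_norm_sub_tendsto_zero]
  have hs : Tendsto (fun n : ℕ => Real.sqrt n) atTop atTop :=
    Real.tendsto_sqrt_atTop.comp tendsto_natCast_atTop_atTop
  have h1 : ∀ K : ℝ, Tendsto (fun n : ℕ => K / Real.sqrt n) atTop (𝓝 0) :=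
    fun K => hs.const_div_atTop K
  refine squeeze_zero' (Filter.Eventually.of_forall fun _ => norm_nonneg _) ?_ (h1
    (2 * (|s|+|t|)^3 + Real.exp ((|s|+|t|)^2/2) * ((1 + (|s*t| + |(t^2-s^2)/2|)^2)/4)))
  filter_upwards [eventually_gt_atTop 0, (h1 (|s|+|t|)).eventually_le_const one_pos] with n hn hC
  exact sz_bound s t n hn hC
end

section
/- There exists a constant c₁ > 0 with the following property. For every integer n ≥ 2, let X be an ℝ²-valued random vector distributed as (μₙ(θ), νₙ(θ)) for θ uniform on [0,1]; let Y be a centered two-dimensional Gaussian vector with covariance matrix diag(1/2, 1/2); and let Z be a centered two-dimensional Gaussian vector with covariance matrix diag((log n)^{−1/8}, (log n)^{−1/8}), independent of X and of Y. Then for all real x, y with |x| ≤ (log n)^{1/4} and |y| ≤ (log n)^{1/4}: |P(X+Z ∈ [−x,x]×[−y,y]) − P(Y+Z ∈ [−x,x]×[−y,y])| ≤ c₁·(log n)^{−1}. -/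
open MeasureTheory ProbabilityTheory
open scoped Real NNReal

lemma tay1 {f f1 : ℝ → ℝ} {M : ℝ} (h : ∀ t, HasDerivAt f (f1 t) t) (b : ∀ t, |f1 t| ≤ M) (a u : ℝ) :
    |f (a+u) - f a| ≤ M * |u| := by
  have := Convex.norm_image_sub_le_of_norm_hasDerivWithin_le (f := f) (f' := f1) (C := M) (s := Set.univ)
    (fun x _ => (h x).hasDerivWithinAt) (fun x _ => b x) convex_univ (Set.mem_univ a) (Set.mem_univ (a+u))
  simpa using this

lemma tay2 {f f1 f2 : ℝ → ℝ} {M : ℝ} (h : ∀ t, HasDerivAt f (f1 t) t)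
    (h1 : ∀ t, HasDerivAt f1 (f2 t) t) (b : ∀ t, |f2 t| ≤ M) (a u : ℝ) :
    |f (a+u) - f a - f1 a * u| ≤ M * |u|^2 := by
  have M0 : 0 ≤ M := (abs_nonneg _).trans (b 0)
  have := Convex.norm_image_sub_le_of_norm_hasDerivWithin_le (f := fun t => f t - f1 a * (t - a))
    (f' := fun t => f1 t - f1 a) (C := M * |u|) (s := Set.uIcc a (a+u))
    (fun x _ => by
      have := (h x).sub (((hasDerivAt_id x).sub_const a).const_mul (f1 a))
      simp only [mul_one] at this
      exact this.hasDerivWithinAt) (fun x hx => by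
        have h3 := tay1 h1 b a (x - a)
        have h4 : |x - a| ≤ |u| := by simpa using Set.abs_sub_left_of_mem_uIcc hx
        simp only [add_sub_cancel] at h3
        exact h3.trans (by gcongr)) (convex_uIcc _ _) Set.left_mem_uIcc Set.right_mem_uIcc
  simp only [Real.norm_eq_abs, add_sub_cancel_left, sub_self, mul_zero, sub_zero] at this
  calc _ = |f (a + u) - f1 a * u - f a| := by ring_nf
    _ ≤ _ := this
    _ = _ := by ring

lemma tay3 {f f1 f2 f3 : ℝ → ℝ} {M : ℝ} (h : ∀ t, HasDerivAt f (f1 t) t)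
    (h1 : ∀ t, HasDerivAt f1 (f2 t) t) (h2 : ∀ t, HasDerivAt f2 (f3 t) t)
    (b : ∀ t, |f3 t| ≤ M) (a u : ℝ) :
    |f (a+u) - f a - f1 a * u - f2 a / 2 * u^2| ≤ M * |u|^3 := by
  have M0 : 0 ≤ M := (abs_nonneg _).trans (b 0)
  have := Convex.norm_image_sub_le_of_norm_hasDerivWithin_le
    (f := fun t => f t - f1 a * (t - a) - f2 a / 2 * (t-a)^2)
    (f' := fun t => f1 t - f1 a - f2 a * (t - a)) (C := M * |u|^2) (s := Set.uIcc a (a+u))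
    (fun x _ => by
      have := ((h x).sub (((hasDerivAt_id x).sub_const a).const_mul (f1 a))).sub
        ((((hasDerivAt_id x).sub_const a).pow 2).const_mul (f2 a / 2))
      refine HasDerivAt.hasDerivWithinAt (HasDerivAt.congr_deriv this ?_)
      simp; ring) (fun x hx => by
        have h3 := tay2 h1 h2 b a (x - a)
        have h4 : |x - a| ≤ |u| := by simpa using Set.abs_sub_left_of_mem_uIcc hx
        simp only [add_sub_cancel] at h3
        exact h3.trans (by gcongr)) (convex_uIcc _ _) Set.left_mem_uIcc Set.right_mem_uIcc
  simp only [Real.norm_eq_abs, add_sub_cancel_left, sub_self, mul_zero, sub_zero] at this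
  calc _ = |f (a + u) - f1 a * u - f2 a / 2 * u^2 - f a| := by ring_nf
    _ ≤ M * |u|^2 * |u| := by simpa using this
    _ = _ := by ring

def HasT (h : ℝ × ℝ → ℝ) (M : ℝ) : Prop :=
  ∀ p, ∃ A1 A2 B11 B12 B22 : ℝ, ∀ u v : ℝ,
    |h (p + (u,v)) - (h p + A1*u + A2*v + B11*u^2 + B12*(u*v) + B22*v^2)| ≤ M*(|u|^3+|v|^3)

/-- functions with three bounded derivatives at scale `q` -/
def Sm (f : ℝ → ℝ) (C q : ℝ) : Prop :=
  ∃ f1 f2 f3 : ℝ → ℝ, (∀ t, HasDerivAt f (f1 t) t) ∧ (∀ t, HasDerivAt f1 (f2 t) t) ∧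
    (∀ t, HasDerivAt f2 (f3 t) t) ∧ (∀ t, |f t| ≤ 1) ∧ (∀ t, |f1 t| ≤ C * q) ∧
    (∀ t, |f2 t| ≤ C * q^2) ∧ (∀ t, |f3 t| ≤ C * q^3)

lemma hasT_of_Sm {f g : ℝ → ℝ} {C q : ℝ} (hC : 1 ≤ C) (hq : 0 ≤ q) (hf : Sm f C q) (hg : Sm g C q) :
    HasT (fun p => f p.1 * g p.2) (3 * C^2 * q^3) := by
  obtain ⟨f1, f2, f3, df, df1, df2, b0, b1, b2, b3⟩ := hf
  obtain ⟨g1, g2, g3, dg, dg1, dg2, c0, c1, c2, c3⟩ := hg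
  rintro ⟨a, b⟩
  refine ⟨f1 a * g b, f a * g1 b, f2 a / 2 * g b, f1 a * g1 b, f a * (g2 b / 2), fun u v => ?_⟩
  simp only [Prod.mk_add_mk]
  have e1 := tay3 df df1 df2 b3 a u
  have e2 := tay3 dg dg1 dg2 c3 b v
  have e3 := tay1 dg c1 b v
  have e4 := tay2 dg dg1 c2 b v
  have hu := abs_nonneg u
  have hv := abs_nonneg v
  have key : f (a+u) * g (b+v) - (f a * g b + f1 a * g b * u + f a * g1 b * v + f2 a / 2 * g b * u^2
      + f1 a * g1 b * (u * v) + f a * (g2 b / 2) * v^2)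
      = (f (a+u) - f a - f1 a * u - f2 a / 2 * u^2) * g (b+v)
        + f2 a * (u^2/2) * (g (b+v) - g b) + f1 a * u * (g (b+v) - g b - g1 b * v)
        + f a * (g (b+v) - g b - g1 b * v - g2 b / 2 * v^2) := by ring
  rw [key]
  have t1 : |(f (a+u) - f a - f1 a * u - f2 a / 2 * u^2) * g (b+v)| ≤ C * q^3 * |u|^3 * 1 := by
    rw [abs_mul]; gcongr; exact c0 _
  have t2 : |f2 a * (u^2/2) * (g (b+v) - g b)| ≤ C * q^2 * |u|^2 * (C * q * |v|) := by
    rw [abs_mul, abs_mul]; gcongr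
    · exact b2 a
    · rw [abs_of_nonneg (by positivity), sq_abs]; nlinarith [sq_nonneg u]
  have t3 : |f1 a * u * (g (b+v) - g b - g1 b * v)| ≤ C * q * |u| * (C * q^2 * |v|^2) := by
    rw [abs_mul, abs_mul]; gcongr
    exact b1 a
  have t4 : |f a * (g (b+v) - g b - g1 b * v - g2 b / 2 * v^2)| ≤ 1 * (C * q^3 * |v|^3) := by
    rw [abs_mul]; gcongr; exact b0 a
  have y : |u|^2 * |v| + |u| * |v|^2 ≤ |u|^3+|v|^3 := by
    nlinarith [mul_nonneg (add_nonneg hu hv) (sq_nonneg (|u|-|v|))]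
  have CC : C ≤ C^2 := by nlinarith
  have q3 : 0 ≤ q^3 := by positivity
  refine (abs_add_le _ _).trans ((add_le_add ((abs_add_le _ _).trans (add_le_add ((abs_add_le _ _).trans
    (add_le_add t1 t2)) t3)) t4).trans ?_)
  have z1 : C * q^3 * (|u|^3+|v|^3) ≤ C^2 * q^3 * (|u|^3+|v|^3) := by gcongr
  have z2 : C^2 * q^3 * (|u|^2 * |v| + |u| * |v|^2) ≤ C^2 * q^3 * (|u|^3+|v|^3) := by gcongr
  have z3 : 0 ≤ C^2 * q^3 * (|u|^3+|v|^3) := by positivity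
  nlinarith

lemma HasT.disc {h : ℝ × ℝ → ℝ} {M p A1 A2 B11 B12 B22} (r : ℝ) (hr : 0 ≤ r) (hM : 0 ≤ M)
   (H : ∀ u v : ℝ,
    |h (p + (u,v)) - (h p + A1*u + A2*v + B11*u^2 + B12*(u*v) + B22*v^2)| ≤ M*(|u|^3+|v|^3)) (θ : ℝ) :
   |(1/8) * ∑ k ∈ Finset.range 8, h (p + (r * Real.sin (2*π*((θ+k)/8)), r * Real.cos (2*π*((θ+k)/8))))
     - (h p + (B11 + B22) * (r^2/2))| ≤ 2*M*r^3 := by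
  have H1 : ∀ φ : ℝ, |h (p + (r * Real.sin φ, r * Real.cos φ)) - (h p + A1*(r * Real.sin φ) + A2*(r * Real.cos φ) + B11*(r * Real.sin φ)^2 + B12*((r * Real.sin φ)*(r * Real.cos φ)) + B22*(r * Real.cos φ)^2)| ≤ 2*M*r^3 := by
    intro φ
    refine (H _ _).trans ?_
    have a1 : |r * Real.sin φ| ≤ r := by
      rw [abs_mul, abs_of_nonneg hr]; exact mul_le_of_le_one_right hr (Real.abs_sin_le_one _)
    have a2 : |r * Real.cos φ| ≤ r := by
      rw [abs_mul, abs_of_nonneg hr]; exact mul_le_of_le_one_right hr (Real.abs_cos_le_one _)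
    calc _ ≤ M * (r^3+r^3) := by gcongr
      _ = _ := by ring
  set φ := 2*π*(θ/8) with hφ
  have ang : ∀ k : ℕ, 2*π*((θ+k)/8) = φ + k * (π/4) := by intro k; rw [hφ]; ring
  simp only [ang]
  have hs := fun k : ℕ => H1 (φ + k * (π/4))
  generalize hG : (fun k : ℕ => h (p + (r * Real.sin (φ + k * (π/4)), r * Real.cos (φ + k * (π/4))))) = G
  have hG' := fun k => congrFun hG k
  simp only [hG'] at hs ⊢
  have p2 : ∀ k : ℕ, φ + (k + 2 : ℕ) * (π/4) = (φ + k * (π/4)) + π/2 := by intro k; push_cast; ring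
  have s2 : ∀ k : ℕ, Real.sin (φ + (k + 2 : ℕ) * (π/4)) = Real.cos (φ + k * (π/4)) := by
    intro k; rw [p2, Real.sin_add_pi_div_two]
  have c2 : ∀ k : ℕ, Real.cos (φ + (k + 2 : ℕ) * (π/4)) = -Real.sin (φ + k * (π/4)) := by
    intro k; rw [p2, Real.cos_add_pi_div_two]
  have h0 := hs 0
  have h1 := hs 1
  have h2 := hs (0+2)
  have h3 := hs (1+2)
  have h4 := hs (0+2+2)
  have h5 := hs (1+2+2)
  have h6 := hs (0+2+2+2)
  have h7 := hs (1+2+2+2)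
  simp only [s2, c2] at h2 h3 h4 h5 h6 h7
  have i0 := Real.sin_sq_add_cos_sq (φ + (0:ℕ) * (π/4))
  have i1 := Real.sin_sq_add_cos_sq (φ + (1:ℕ) * (π/4))
  generalize Real.sin (φ + (0:ℕ) * (π/4)) = S0 at *
  generalize Real.cos (φ + (0:ℕ) * (π/4)) = C0 at *
  generalize Real.sin (φ + (1:ℕ) * (π/4)) = S1 at *
  generalize Real.cos (φ + (1:ℕ) * (π/4)) = C1 at *
  simp only [Finset.sum_range_succ, Finset.sum_range_zero]
  norm_num at h2 h3 h4 h5 h6 h7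
  have j0 : B11 * (r^2 * (S0^2+C0^2)) + B22 * (r^2 * (S0^2+C0^2)) = B11 * r^2 + B22 * r^2 := by rw [i0]; ring
  have j1 : B11 * (r^2 * (S1^2+C1^2)) + B22 * (r^2 * (S1^2+C1^2)) = B11 * r^2 + B22 * r^2 := by rw [i1]; ring
  rw [abs_le] at *
  constructor <;> linarith [h0.1,h0.2,h1.1,h1.2,h2.1,h2.2,h3.1,h3.2,h4.1,h4.2,h5.1,h5.2,h6.1,h6.2,h7.1,h7.2]

noncomputable def g2 (v : ℝ≥0) : Measure (ℝ × ℝ) := (gaussianReal 0 v).prod (gaussianReal 0 v)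

instance (v : ℝ≥0) : IsProbabilityMeasure (g2 v) := by unfold g2; infer_instance

lemma g2_conv (v w : ℝ≥0) (h : ℝ × ℝ → ℝ) (hc : Continuous h) (hb : ∃ C, ∀ p, |h p| ≤ C) :
    ∫ a, ∫ b, h (a + b) ∂(g2 w) ∂(g2 v) = ∫ a, h a ∂(g2 (v + w)) := by
  obtain ⟨C, hC⟩ := hb
  have hconv : gaussianReal 0 (v+w) = ((gaussianReal 0 v).prod (gaussianReal 0 w)).map (fun p => p.1 + p.2) := by
    have := gaussianReal_conv_gaussianReal (m₁ := 0) (m₂ := 0) (v₁ := v) (v₂ := w)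
    rw [add_zero] at this
    rw [← this]; rfl
  have int : ∀ {α : Type} [MeasurableSpace α] (μ : Measure α) [IsProbabilityMeasure μ] (k : α → ℝ × ℝ),
      Measurable k → Integrable (fun a => h (k a)) μ := by
    intro α _ μ _ k hk
    exact Integrable.of_bound (hc.measurable.comp hk).aestronglyMeasurable C (Filter.Eventually.of_forall fun a => hC _)
  have hmp : MeasurePreserving (fun q : (ℝ × ℝ) × (ℝ × ℝ) => ((q.1.1 + q.1.2, q.2.1 + q.2.2) : ℝ × ℝ))
     (((gaussianReal 0 v).prod (gaussianReal 0 w)).prod ((gaussianReal 0 v).prod (gaussianReal 0 w)))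
     (g2 (v+w)) := by
    unfold g2
    have h1 : MeasurePreserving (fun p : ℝ × ℝ => p.1 + p.2)  ((gaussianReal 0 v).prod (gaussianReal 0 w)) (gaussianReal 0 (v+w)) :=
      ⟨by fun_prop, hconv.symm⟩
    exact h1.prod h1
  rw [← hmp.map_eq, integral_map hmp.measurable.aemeasurable hc.aestronglyMeasurable]
  rw [integral_prod _ (int _ _ hmp.measurable)]
  rw [integral_prod _ (Integrable.integral_prod_left (int _ (fun q : (ℝ × ℝ) × (ℝ × ℝ) => (q.1.1 + q.1.2, q.2.1 + q.2.2)) (by fun_prop)))]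
  unfold g2
  rw [integral_prod _ (Integrable.integral_prod_left (int (((gaussianReal 0 v).prod (gaussianReal 0 v)).prod ((gaussianReal 0 w).prod (gaussianReal 0 w))) (fun q : (ℝ × ℝ) × (ℝ × ℝ) => q.1 + q.2) (by fun_prop)))]
  congr 1
  ext a1
  have e1 : ∀ a2, ∫ b, h ((a1, a2) + b) ∂((gaussianReal 0 w).prod (gaussianReal 0 w))
      = ∫ b1, ∫ b2, h (a1 + b1, a2 + b2) ∂(gaussianReal 0 w) ∂(gaussianReal 0 w) := by
    intro a2
    rw [integral_prod _ (int _ _ (by fun_prop))]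
    rfl
  have e2 : ∀ b1, ∫ q : ℝ × ℝ, h (a1 + b1, q.1 + q.2) ∂((gaussianReal 0 v).prod (gaussianReal 0 w))
      = ∫ a2, ∫ b2, h (a1 + b1, a2 + b2) ∂(gaussianReal 0 w) ∂(gaussianReal 0 v) := by
    intro b1
    rw [integral_prod _ (int _ _ (by fun_prop))]
  simp only [e1, e2]
  rw [integral_integral_swap]
  exact Integrable.integral_prod_left (int (((gaussianReal 0 v).prod (gaussianReal 0 w)).prod (gaussianReal 0 w)) (fun q : (ℝ × ℝ) × ℝ => (a1 + q.1.2, q.1.1 + q.2)) (by fun_prop))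

noncomputable def c3 : ℝ := ∫ x, |x|^3 ∂(gaussianReal 0 1)

lemma c3_nonneg : 0 ≤ c3 := integral_nonneg fun x => by positivity

lemma gauss_int_pow (v : ℝ≥0) (k : ℕ) (hk : k ≠ 0) : Integrable (fun x => |x|^k) (gaussianReal 0 v) := by
  have := (memLp_id_gaussianReal (μ := 0) (v := v) (k : ℝ≥0)).integrable_norm_pow (by simpa using hk)
  simpa using this

lemma gauss_third (v : ℝ≥0) : ∫ x, |x|^3 ∂(gaussianReal 0 v) = (√v)^3 * c3 := by
  have h := gaussianReal_map_const_mul (μ := 0) (v := 1) (√(v:ℝ))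
  have e : (NNReal.mk ((√(v:ℝ))^2) (sq_nonneg _) * 1 : ℝ≥0) = v := by
    ext; simp
  rw [e, mul_zero] at h
  rw [← h, integral_map (by fun_prop) (by fun_prop), c3, ← integral_const_mul]
  congr 1; ext x
  rw [abs_mul, mul_pow, abs_of_nonneg (Real.sqrt_nonneg _)]

lemma gauss_second (v : ℝ≥0) : ∫ x, x^2 ∂(gaussianReal 0 v) = v := by
  have h := variance_id_gaussianReal (μ := 0) (v := v)
  rw [variance_eq_integral (by fun_prop)] at h
  simpa using h

lemma HasT.gauss {h : ℝ × ℝ → ℝ} {M p A1 A2 B11 B12 B22} (v : ℝ≥0)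
   (hc : Continuous h) (hb : ∃ C, ∀ p, |h p| ≤ C)
   (H : ∀ u v : ℝ,
    |h (p + (u,v)) - (h p + A1*u + A2*v + B11*u^2 + B12*(u*v) + B22*v^2)| ≤ M*(|u|^3+|v|^3)) :
   |∫ g, h (p + g) ∂(g2 v) - (h p + (B11 + B22) * v)| ≤ 2 * M * ((√v)^3 * c3) := by
  obtain ⟨C, hC⟩ := hb
  have i1 : Integrable (fun x : ℝ => x) (gaussianReal 0 v) := by
    have := gauss_int_pow v 1 one_ne_zero
    simp only [pow_one] at this
    exact (integrable_norm_iff (by fun_prop)).1 this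
  have i2 : Integrable (fun x : ℝ => x^2) (gaussianReal 0 v) := by
    simpa using gauss_int_pow v 2 two_ne_zero
  have i3 := gauss_int_pow v 3 three_ne_zero
  have ih : Integrable (fun g => h (p + g)) (g2 v) :=
    Integrable.of_bound (by fun_prop) C (Filter.Eventually.of_forall fun a => hC _)
  have j0 : Integrable (fun _ : ℝ × ℝ => h p) (g2 v) := integrable_const _
  have j1 : Integrable (fun g : ℝ × ℝ => A1 * g.1) (g2 v) := (i1.comp_fst _).const_mul _
  have j2 : Integrable (fun g : ℝ × ℝ => A2 * g.2) (g2 v) := (i1.comp_snd _).const_mul _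
  have j3 : Integrable (fun g : ℝ × ℝ => B11 * g.1^2) (g2 v) := (i2.comp_fst _).const_mul _
  have j4 : Integrable (fun g : ℝ × ℝ => B12 * (g.1 * g.2)) (g2 v) := (i1.mul_prod i1).const_mul _
  have j5 : Integrable (fun g : ℝ × ℝ => B22 * g.2^2) (g2 v) := (i2.comp_snd _).const_mul _
  have j6 : Integrable (fun g : ℝ × ℝ => |g.1|^3) (g2 v) := (i3.comp_fst _)
  have j7 : Integrable (fun g : ℝ × ℝ => |g.2|^3) (g2 v) := (i3.comp_snd _)
  have z : ∫ x, x ∂(gaussianReal 0 v) = 0 := integral_id_gaussianReal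
  have k1 : ∫ g : ℝ × ℝ, g.1 ∂(g2 v) = 0 := by
    unfold g2; rw [integral_fun_fst (fun x : ℝ => x), z]; simp
  have k2 : ∫ g : ℝ × ℝ, g.2 ∂(g2 v) = 0 := by
    unfold g2; rw [integral_fun_snd (fun x : ℝ => x), z]; simp
  have k3 : ∫ g : ℝ × ℝ, g.1^2 ∂(g2 v) = v := by
    unfold g2; rw [integral_fun_fst (fun x : ℝ => x^2), gauss_second]; simp
  have k5 : ∫ g : ℝ × ℝ, g.2^2 ∂(g2 v) = v := by
    unfold g2; rw [integral_fun_snd (fun x : ℝ => x^2), gauss_second]; simp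
  have k4 : ∫ g : ℝ × ℝ, g.1 * g.2 ∂(g2 v) = 0 := by
    unfold g2; rw [integral_prod_mul (fun x : ℝ => x) (fun x : ℝ => x), z]; simp
  have k6 : ∫ g : ℝ × ℝ, |g.1|^3 ∂(g2 v) = (√v)^3 * c3 := by
    unfold g2; rw [integral_fun_fst (fun x : ℝ => |x|^3), gauss_third]; simp
  have k7 : ∫ g : ℝ × ℝ, |g.2|^3 ∂(g2 v) = (√v)^3 * c3 := by
    unfold g2; rw [integral_fun_snd (fun x : ℝ => |x|^3), gauss_third]; simp
  have hpoly : ∫ g : ℝ × ℝ, (h p + A1*g.1 + A2*g.2 + B11*g.1^2 + B12*(g.1*g.2) + B22*g.2^2) ∂(g2 v)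
      = h p + (B11 + B22) * v := by
    rw [integral_add ((((j0.fun_add j1).fun_add j2).fun_add j3).fun_add j4) j5,
      integral_add (((j0.fun_add j1).fun_add j2).fun_add j3) j4,
      integral_add ((j0.fun_add j1).fun_add j2) j3,
      integral_add (j0.fun_add j1) j2,
      integral_add j0 j1]
    simp only [integral_const_mul, k1, k2, k3, k4, k5]
    simp; ring
  rw [← hpoly, ← integral_sub ih (((((j0.fun_add j1).fun_add j2).fun_add j3).fun_add j4).fun_add j5)]
  rw [← Real.norm_eq_abs]
  calc _ ≤ ∫ g : ℝ × ℝ, M * (|g.1|^3 + |g.2|^3) ∂(g2 v) :=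
        norm_integral_le_of_norm_le ((j6.fun_add j7).const_mul M) (Filter.Eventually.of_forall fun g => H g.1 g.2)
    _ = _ := by
      have e6 := integral_add j6 j7
      rw [integral_const_mul, e6, k6, k7]; ring

lemma split8 (G : ℝ → ℝ) (hG : Continuous G) :
    ∫ θ in (0:ℝ)..1, G θ = ∫ θ in (0:ℝ)..1, (1/8) * ∑ k ∈ Finset.range 8, G ((θ + k)/8) := by
  rw [intervalIntegral.integral_const_mul, intervalIntegral.integral_finsetSum
    (fun k _ => Continuous.intervalIntegrable (by fun_prop) _ _)]
  have e : ∀ k : ℕ, ∫ θ in (0:ℝ)..1, G ((θ + k)/8) = 8 * ∫ θ in ((k:ℝ)/8)..((k+1:ℕ):ℝ)/8, G θ := by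
    intro k
    rw [intervalIntegral.integral_comp_add_right (fun x => G (x / 8)), intervalIntegral.integral_comp_div _ (by norm_num)]
    rw [smul_eq_mul, zero_add]; push_cast; rw [add_comm 1 (k:ℝ)]
  simp only [e]
  rw [← Finset.mul_sum, intervalIntegral.sum_integral_adjacent_intervals (a := fun k : ℕ => (k:ℝ)/8)
    (fun k _ => hG.intervalIntegrable _ _)]
  norm_num
  ring

noncomputable def SS (r : ℝ) (m : ℕ) (θ : ℝ) : ℝ × ℝ :=
  (r * ∑ j ∈ Finset.range m, Real.sin (2*π*(8^j*θ)), r * ∑ j ∈ Finset.range m, Real.cos (2*π*(8^j*θ)))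

lemma SS_cont (r : ℝ) (m : ℕ) : Continuous (SS r m) := by
  unfold SS; fun_prop

lemma SS_zero (r : ℝ) (θ : ℝ) : SS r 0 θ = 0 := by simp [SS]

lemma SS_nat (r : ℝ) (m : ℕ) (θ : ℝ) (k : ℕ) : SS r m (θ + k) = SS r m θ := by
  have : ∀ j : ℕ, 2*π*(8^j*(θ + k)) = 2*π*(8^j*θ) + (8^j*k : ℕ) * (2*π) := by
    intro j; push_cast; ring
  simp only [SS, this, Real.sin_add_nat_mul_two_pi, Real.cos_add_nat_mul_two_pi]

lemma SS_succ (r : ℝ) (m : ℕ) (θ : ℝ) :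
    SS r (m+1) θ = (r * Real.sin (2*π*θ), r * Real.cos (2*π*θ)) + SS r m (8*θ) := by
  have : ∀ j : ℕ, 2*π*(8^(j+1)*θ) = 2*π*(8^j*(8*θ)) := by intro j; ring
  simp only [SS, Finset.sum_range_succ', this]
  ext <;> simp <;> ring

lemma SS_succ' (r : ℝ) (m : ℕ) (θ : ℝ) (k : ℕ) :
    SS r (m+1) ((θ + k)/8) = SS r m θ + (r * Real.sin (2*π*((θ+k)/8)), r * Real.cos (2*π*((θ+k)/8))) := by
  rw [SS_succ, mul_div_cancel₀ _ (by norm_num), SS_nat, add_comm]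

lemma main_ind {h : ℝ × ℝ → ℝ} {M : ℝ} (hM : 0 ≤ M) (hT : HasT h M) (hc : Continuous h)
    (hb : ∃ C, ∀ p, |h p| ≤ C) (r : ℝ) (hr : 0 ≤ r) (v : ℝ≥0) (hv : (v : ℝ) = r^2/2) (m : ℕ) :
    ∀ p, |(∫ θ in (0:ℝ)..1, h (p + SS r m θ)) - ∫ g, h (p + g) ∂(g2 (m * v))|
      ≤ m * (2 * M * r^3 * (1 + c3)) := by
  induction m with
  | zero =>
    intro p
    simp [SS_zero, g2, Measure.dirac_prod_dirac]
    rw [← Prod.zero_eq_mk, add_zero, sub_self]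
  | succ m ih =>
    intro p
    have hb' := hb
    obtain ⟨C, hC⟩ := hb
    have hS := SS_cont r m
    have int : ∀ {α : Type} [MeasurableSpace α] (μ : Measure α) [IsFiniteMeasure μ] (k : α → ℝ × ℝ),
        Measurable k → Integrable (fun a => h (k a)) μ := by
      intro α _ μ _ k hk
      exact Integrable.of_bound (hc.measurable.comp hk).aestronglyMeasurable C (Filter.Eventually.of_forall fun a => hC _)
    have hsv : (√(v:ℝ))^3 ≤ r^3 := by
      gcongr
      rw [hv]
      apply Real.sqrt_le_iff.2 ⟨hr, by nlinarith [sq_nonneg r]⟩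
    have hA : ∫ θ in (0:ℝ)..1, h (p + SS r (m+1) θ) = ∫ θ in (0:ℝ)..1,
        (1/8) * ∑ k ∈ Finset.range 8, h ((p + SS r m θ) + (r * Real.sin (2*π*((θ+k)/8)), r * Real.cos (2*π*((θ+k)/8)))) := by
      have hS' := SS_cont r (m+1)
      rw [split8 _ (by fun_prop)]
      simp only [SS_succ', add_assoc]
    have hstep : ∀ θ : ℝ, ‖(1/8) * ∑ k ∈ Finset.range 8, h ((p + SS r m θ) + (r * Real.sin (2*π*((θ+k)/8)), r * Real.cos (2*π*((θ+k)/8))))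
        - ∫ g, h ((p + SS r m θ) + g) ∂(g2 v)‖ ≤ 2 * M * r^3 * (1 + c3) := by
      intro θ
      obtain ⟨A1, A2, B11, B12, B22, H⟩ := hT (p + SS r m θ)
      have d := HasT.disc r hr hM H θ
      have g := HasT.gauss v hc hb' H
      rw [hv] at g
      rw [← hv] at g
      have g' : 2 * M * ((√(v:ℝ))^3 * c3) ≤ 2 * M * (r^3 * c3) := by
        have := c3_nonneg
        gcongr
      rw [← hv] at d
      rw [Real.norm_eq_abs]
      rw [abs_le] at *
      constructor <;> linarith [d.1, d.2, g.1, g.2]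
    have iB : Integrable (fun θ => ∫ g, h ((p + SS r m θ) + g) ∂(g2 v)) (volume.restrict (Set.Ioc (0:ℝ) 1)) :=
      Integrable.integral_prod_left (int ((volume.restrict (Set.Ioc (0:ℝ) 1)).prod (g2 v)) (fun q : ℝ × (ℝ × ℝ) => (p + SS r m q.1) + q.2)
        (by fun_prop))
    have h1 : ‖(∫ θ in (0:ℝ)..1, h (p + SS r (m+1) θ)) - ∫ θ in (0:ℝ)..1, ∫ g, h ((p + SS r m θ) + g) ∂(g2 v)‖
        ≤ 2 * M * r^3 * (1 + c3) := by
      rw [hA, ← intervalIntegral.integral_sub]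
      · have := intervalIntegral.norm_integral_le_of_norm_le_const (a := 0) (b := 1) (fun θ _ => hstep θ)
        simpa using this
      · apply Continuous.intervalIntegrable; fun_prop
      · rw [intervalIntegrable_iff_integrableOn_Ioc_of_le zero_le_one]; exact iB
    have hsw : ∫ θ in (0:ℝ)..1, ∫ g, h ((p + SS r m θ) + g) ∂(g2 v) = ∫ g, (∫ θ in (0:ℝ)..1, h ((p + g) + SS r m θ)) ∂(g2 v) := by
      simp only [intervalIntegral.integral_of_le zero_le_one]
      rw [integral_integral_swap]
      · simp only [add_right_comm]
      · exact int ((volume.restrict (Set.Ioc (0:ℝ) 1)).prod (g2 v)) (fun q : ℝ × (ℝ × ℝ) => (p + SS r m q.1) + q.2)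
          (by fun_prop)
    have hcv : ∫ g, h (p + g) ∂(g2 ((m+1 : ℕ) * v)) = ∫ a, ∫ b, h ((p + a) + b) ∂(g2 (m * v)) ∂(g2 v) := by
      have := g2_conv v (m * v) (fun q => h (p + q)) (by fun_prop) ⟨C, fun q => hC _⟩
      simp only [← add_assoc] at this
      rw [this]
      congr 2
      push_cast; ring
    have h2 : ‖(∫ g, (∫ θ in (0:ℝ)..1, h ((p + g) + SS r m θ)) ∂(g2 v)) - ∫ a, ∫ b, h ((p + a) + b) ∂(g2 (m * v)) ∂(g2 v)‖
        ≤ m * (2 * M * r^3 * (1 + c3)) := by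
      rw [← integral_sub]
      · have := norm_integral_le_of_norm_le_const (μ := g2 v) (f := fun g => (∫ θ in (0:ℝ)..1, h ((p + g) + SS r m θ)) - ∫ b, h ((p + g) + b) ∂(g2 (m * v)))
          (Filter.Eventually.of_forall fun g => ih (p + g))
        simpa using this
      · simp only [intervalIntegral.integral_of_le zero_le_one]
        exact Integrable.integral_prod_left (int ((g2 v).prod (volume.restrict (Set.Ioc (0:ℝ) 1))) (fun q : (ℝ × ℝ) × ℝ => (p + q.1) + SS r m q.2)
          (by fun_prop))
      · exact Integrable.integral_prod_left (int ((g2 v).prod (g2 (m*v))) (fun q : (ℝ × ℝ) × (ℝ × ℝ) => (p + q.1) + q.2)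
          (by fun_prop))
    rw [hcv]
    rw [hsw] at h1
    rw [Real.norm_eq_abs] at h1 h2
    refine (abs_sub_le _ _ _).trans ((add_le_add h1 h2).trans (le_of_eq ?_))
    push_cast; ring

noncomputable def HH (s : ℝ≥0) (x a : ℝ) : ℝ := (gaussianReal 0 s).real (Set.Icc (-x-a) (x-a))

lemma Sm_of_density {ρ ρ1 ρ2 f : ℝ → ℝ} {K q x : ℝ} (d : ∀ t, HasDerivAt ρ (ρ1 t) t)
    (d1 : ∀ t, HasDerivAt ρ1 (ρ2 t) t) (b : ∀ t, |ρ t| ≤ K * q) (b1 : ∀ t, |ρ1 t| ≤ K * q^2)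
    (b2 : ∀ t, |ρ2 t| ≤ K * q^3) (hf : ∀ a, f a = ∫ t in (-x-a)..(x-a), ρ t) (hf1 : ∀ a, |f a| ≤ 1) :
    Sm f (2*K) q := by
  have hcont : Continuous ρ := continuous_iff_continuousAt.2 fun t => (d t).continuousAt
  have ds : ∀ {g g' : ℝ → ℝ} (y : ℝ), (∀ t, HasDerivAt g (g' t) t) → ∀ t, HasDerivAt (fun a => g (y - a)) (-g' (y - t)) t := by
    intro g g' y hg t
    have := (hg (y - t)).comp t ((hasDerivAt_id t).const_sub y)
    simpa [Function.comp_def] using this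
  have hF : ∀ t, HasDerivAt (fun s => ∫ u in (0:ℝ)..s, ρ u) (ρ t) t := fun t =>
    intervalIntegral.integral_hasDerivAt_right (hcont.intervalIntegrable _ _)
      (hcont.stronglyMeasurableAtFilter _ _) hcont.continuousAt
  have tri : ∀ A B D : ℝ, |A| ≤ D → |B| ≤ D → |-A - -B| ≤ 2 * D := by
    intro A B D h1 h2; rw [abs_le] at *; constructor <;> linarith [h1.1, h1.2, h2.1, h2.2]
  refine ⟨fun a => -ρ (x - a) - -ρ (-x - a), fun a => - -ρ1 (x - a) - - -ρ1 (-x - a),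
    fun a => - - -ρ2 (x - a) - - - -ρ2 (-x - a), ?_, ?_, ?_, hf1, ?_, ?_, ?_⟩
  · intro t
    have := (ds x hF t).sub (ds (-x) hF t)
    refine this.congr_of_eventuallyEq (Filter.Eventually.of_forall fun a => ?_)
    rw [hf a]
    simp only [Pi.sub_apply]
    rw [intervalIntegral.integral_interval_sub_left (hcont.intervalIntegrable _ _) (hcont.intervalIntegrable _ _)]
  · intro t
    exact (ds x d t).neg.sub (ds (-x) d t).neg
  · intro t
    exact (ds x d1 t).neg.neg.sub (ds (-x) d1 t).neg.neg
  · intro t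
    rw [mul_assoc]
    exact tri _ _ _ (b _) (b _)
  · intro t
    rw [mul_assoc]
    exact tri _ _ _ (by simpa using b1 _) (by simpa using b1 _)
  · intro t
    rw [mul_assoc]
    exact tri _ _ _ (by simpa using b2 _) (by simpa using b2 _)

lemma HH_Sm (s : ℝ≥0) (hs : 0 < s) (x : ℝ) : Sm (HH s x) 4 ((√s)⁻¹) := by
  have hs' : (0:ℝ) < s := hs
  have hq : 0 < (√(s:ℝ))⁻¹ := by positivity
  rcases lt_or_ge x 0 with hx | hx
  · have : HH s x = fun _ => 0 := by
      ext a
      rw [HH, Set.Icc_eq_empty (by linarith)]; simp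
    rw [this]
    refine ⟨fun _ => 0, fun _ => 0, fun _ => 0, fun t => hasDerivAt_const _ _, fun t => hasDerivAt_const _ _,
      fun t => hasDerivAt_const _ _, ?_, ?_, ?_, ?_⟩ <;> intro t <;> simp [hs'.le]
  set q := (√(s:ℝ))⁻¹ with hqd
  set c := (√(2 * π * s))⁻¹ with hcd
  have hc0 : 0 ≤ c := by positivity
  have hcq : c ≤ q := by
    rw [hcd, hqd]
    gcongr
    nlinarith [Real.pi_gt_three]
  have hq2 : q^2 = (s:ℝ)⁻¹ := by rw [hqd, inv_pow, Real.sq_sqrt hs'.le]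
  have hpdf : ∀ t, gaussianPDFReal 0 s t = c * Real.exp (-(q*t)^2/2) := by
    intro t
    rw [gaussianPDFReal, ← hcd, mul_pow, hq2]
    congr 2
    field_simp
    ring
  have d0 : ∀ t, HasDerivAt (fun t => Real.exp (-(q*t)^2/2)) (Real.exp (-(q*t)^2/2) * (-(q * (q * t)))) t := by
    intro t
    have h1 : HasDerivAt (fun t => -(q*t)^2/2) (-(q*(q*t))) t := by
      have := ((((hasDerivAt_id t).const_mul q).pow 2).neg).div_const 2
      refine this.congr_deriv ?_
      simp; ring
    exact h1.exp
  have e1 : ∀ w : ℝ, 1 + w^2/2 ≤ Real.exp (w^2/2) := fun w => by linarith [Real.add_one_le_exp (w^2/2)]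
  have ee : ∀ w : ℝ, Real.exp (w^2/2) * Real.exp (-w^2/2) = 1 := fun w => by
    rw [← Real.exp_add]; simp [neg_div]
  have bd : ∀ w z : ℝ, |z| ≤ 2 * (1 + w^2/2) → |z| * Real.exp (-w^2/2) ≤ 2 := by
    intro w z hz
    calc _ ≤ 2 * Real.exp (w^2/2) * Real.exp (-w^2/2) := by
            gcongr; linarith [e1 w]
      _ = 2 := by rw [mul_assoc, ee]; ring
  have := Sm_of_density (K := 2) (q := q) (x := x) (f := HH s x) (ρ := fun t => c * Real.exp (-(q*t)^2/2))
    (ρ1 := fun t => c * (Real.exp (-(q*t)^2/2) * (-(q * (q * t)))))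
    (ρ2 := fun t => c * (Real.exp (-(q*t)^2/2) * (q^2 * ((q*t)^2 - 1))))
    (fun t => (d0 t).const_mul c)
    (fun t => by
      have h2 : HasDerivAt (fun t => -(q * (q * t))) (-(q*q)) t := by
        have := (((hasDerivAt_id t).const_mul q).const_mul q).neg
        exact this.congr_deriv (by simp)
      refine (((d0 t).mul h2).const_mul c).congr_deriv ?_
      ring)
    (fun t => by
      have := bd (q*t) 1 (by simp; nlinarith [sq_nonneg (q*t)])
      rw [abs_of_nonneg (by positivity)]
      rw [abs_one, one_mul] at this
      calc _ ≤ q * 2 := by gcongr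
        _ = _ := by ring)
    (fun t => by
      have := bd (q*t) (q*t) (by rw [abs_le]; constructor <;> nlinarith [sq_nonneg (q*t-1), sq_nonneg (q*t+1)])
      rw [abs_mul, abs_mul, abs_neg, abs_mul q, abs_of_nonneg hc0, abs_of_pos hq, abs_of_pos (Real.exp_pos _)]
      calc _ = c * q * (|q*t| * Real.exp (-(q*t)^2/2)) := by ring
        _ ≤ q * q * 2 := by gcongr
        _ = _ := by ring)
    (fun t => by
      have := bd (q*t) ((q*t)^2-1) (by rw [abs_le]; constructor <;> nlinarith [sq_nonneg (q*t)])
      rw [abs_mul, abs_mul, abs_mul (q^2), abs_of_nonneg hc0, abs_of_pos (pow_pos hq 2), abs_of_pos (Real.exp_pos _)]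
      calc _ = c * q^2 * (|(q*t)^2-1| * Real.exp (-(q*t)^2/2)) := by ring
        _ ≤ q * q^2 * 2 := by gcongr
        _ = _ := by ring)
    (fun a => by
      simp only [← hpdf]
      rw [HH, measureReal_def, gaussianReal_apply_eq_integral _ hs.ne', ENNReal.toReal_ofReal
        (integral_nonneg fun _ => gaussianPDFReal_nonneg _ _ _), integral_Icc_eq_integral_Ioc,
        intervalIntegral.integral_of_le (by linarith)])
    (fun a => by
      rw [HH, abs_of_nonneg measureReal_nonneg]; exact measureReal_le_one)
  norm_num at this
  exact this

lemma prob_eq {Ω : Type} [MeasurableSpace Ω] (P : Measure Ω) [IsProbabilityMeasure P] (X Z : Ω → ℝ × ℝ)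
    (hX : Measurable X) (hZ : Measurable Z) (s : ℝ≥0) (hZl : Measure.map Z P = (gaussianReal 0 s).prod (gaussianReal 0 s))
    (hi : IndepFun X Z P) (x y : ℝ) :
    (P {ω | X ω + Z ω ∈ Set.Icc (-x) x ×ˢ Set.Icc (-y) y}).toReal =
      ∫ a, HH s x a.1 * HH s y a.2 ∂(Measure.map X P) := by
  have : IsProbabilityMeasure (Measure.map X P) := Measure.isProbabilityMeasure_map hX.aemeasurable
  have hm : MeasurableSet {q : (ℝ × ℝ) × (ℝ × ℝ) | q.1 + q.2 ∈ Set.Icc (-x) x ×ˢ Set.Icc (-y) y} :=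
    (measurableSet_Icc.prod measurableSet_Icc).preimage (by fun_prop)
  have h1 := (indepFun_iff_map_prod_eq_prod_map_map hX.aemeasurable hZ.aemeasurable).1 hi
  have h2 : P {ω | X ω + Z ω ∈ Set.Icc (-x) x ×ˢ Set.Icc (-y) y} =
      (Measure.map (fun ω => (X ω, Z ω)) P) {q : (ℝ × ℝ) × (ℝ × ℝ) | q.1 + q.2 ∈ Set.Icc (-x) x ×ˢ Set.Icc (-y) y} := by
    rw [Measure.map_apply (hX.prodMk hZ) hm]; rfl
  rw [h2, h1, hZl, Measure.prod_apply hm, ← integral_toReal (measurable_measure_prodMk_left hm).aemeasurable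
    (Filter.Eventually.of_forall fun a => measure_lt_top _ _)]
  congr 1
  ext a
  have : Prod.mk a ⁻¹' {q : (ℝ × ℝ) × (ℝ × ℝ) | q.1 + q.2 ∈ Set.Icc (-x) x ×ˢ Set.Icc (-y) y}
      = Set.Icc (-x-a.1) (x-a.1) ×ˢ Set.Icc (-y-a.2) (y-a.2) := by
    ext b
    simp only [Set.mem_preimage, Set.mem_ofPred_eq, Set.mem_prod, Set.mem_Icc, Prod.fst_add, Prod.snd_add]
    constructor <;> rintro ⟨⟨_, _⟩, _, _⟩ <;> refine ⟨⟨?_, ?_⟩, ?_, ?_⟩ <;> linarith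
  rw [this, Measure.prod_prod, ENNReal.toReal_mul]
  rfl

lemma lac_eq (n : ℕ) (θ : ℝ) : (lacunarySin n θ, lacunaryCos n θ) = SS ((√(n:ℝ))⁻¹) n (8*θ) := by
  have : ∀ j : ℕ, 2*π*(8^j*(8*θ)) = 2*π*8^(1+j)*θ := by intro j; ring
  simp only [lacunarySin, lacunaryCos, SS, this]
  rw [← Finset.Ico_add_one_right_eq_Icc, Finset.sum_Ico_eq_sum_range, Finset.sum_Ico_eq_sum_range]
  simp only [Nat.add_sub_cancel, div_eq_inv_mul]

theorem smoothed_distribution_comparison :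
    ∃ c₁ : ℝ, 0 < c₁ ∧
      ∀ (n : ℕ), 2 ≤ n →
      ∀ (Ω : Type) (_ : MeasurableSpace Ω) (P : Measure Ω), IsProbabilityMeasure P →
      ∀ (X Y Z : Ω → ℝ × ℝ), Measurable X → Measurable Y → Measurable Z →
      Measure.map X P =
        Measure.map (fun θ : ℝ => (lacunarySin n θ, lacunaryCos n θ))
          (volume.restrict (Set.Icc (0:ℝ) 1)) →
      Measure.map Y P =
        (gaussianReal 0 ((1:ℝ≥0)/2)).prod (gaussianReal 0 ((1:ℝ≥0)/2)) →
      Measure.map Z P =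
        (gaussianReal 0 ((Real.log n ^ (-(1/8 : ℝ))).toNNReal)).prod
          (gaussianReal 0 ((Real.log n ^ (-(1/8 : ℝ))).toNNReal)) →
      IndepFun X Z P → IndepFun Y Z P →
      ∀ x y : ℝ, |x| ≤ Real.log n ^ ((1:ℝ)/4) → |y| ≤ Real.log n ^ ((1:ℝ)/4) →
        |(P {ω | X ω + Z ω ∈ Set.Icc (-x) x ×ˢ Set.Icc (-y) y}).toReal -
            (P {ω | Y ω + Z ω ∈ Set.Icc (-x) x ×ˢ Set.Icc (-y) y}).toReal| ≤
          c₁ * (Real.log n)⁻¹ := by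
  have hc3 := c3_nonneg
  refine ⟨18 * (96 * (1 + c3)), by positivity, ?_⟩
  intro n hn Ω _ P _ X Y Z hX hY hZ lX lY lZ iX iY x y _ _
  have hn2 : (2:ℝ) ≤ n := by exact_mod_cast hn
  have hn0 : (0:ℝ) < n := by linarith
  set L := Real.log n with hL
  have hL0 : 0 < L := Real.log_pos (by linarith)
  set s := (L ^ (-(1/8 : ℝ))).toNNReal with hs
  have hsr : (s:ℝ) = L ^ (-(1/8 : ℝ)) := Real.coe_toNNReal _ (by positivity)
  have hs0 : 0 < s := by
    rw [hs, Real.toNNReal_pos]; positivity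
  set q := (√(s:ℝ))⁻¹ with hq
  have hq0 : 0 ≤ q := by positivity
  have hq3 : q^3 ≤ 1 + L := by
    have : q^3 = L ^ (3/16 : ℝ) := by
      rw [hq, hsr, Real.sqrt_eq_rpow, ← Real.rpow_mul hL0.le, ← Real.rpow_neg hL0.le, ← Real.rpow_natCast, ← Real.rpow_mul hL0.le]
      norm_num
    rw [this]
    calc _ ≤ (1 + L) ^ (3/16 : ℝ) := by gcongr; linarith
      _ ≤ (1 + L) ^ (1 : ℝ) := Real.rpow_le_rpow_of_exponent_le (by linarith) (by norm_num)
      _ = _ := Real.rpow_one _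
  have S1 := HH_Sm s hs0 x
  have S2 := HH_Sm s hs0 y
  have cont : ∀ {f : ℝ → ℝ}, Sm f 4 q → Continuous f := by
    rintro f ⟨f1, _, _, h, _⟩
    exact continuous_iff_continuousAt.2 fun t => (h t).continuousAt
  have bdd : ∀ {f : ℝ → ℝ}, Sm f 4 q → ∀ t, |f t| ≤ 1 := by
    rintro f ⟨f1, _, _, _, _, _, h, _⟩; exact h
  have hT := hasT_of_Sm (by norm_num) hq0 S1 S2
  rw [prob_eq P X Z hX hZ s lZ iX, prob_eq P Y Z hY hZ s lZ iY, lX, lY]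
  have C1 := cont S1
  have C2 := cont S2
  have hhc : Continuous (fun p : ℝ × ℝ => HH s x p.1 * HH s y p.2) := by fun_prop
  have hhb : ∀ p : ℝ × ℝ, |HH s x p.1 * HH s y p.2| ≤ 1 := by
    intro p; rw [abs_mul]; exact mul_le_one₀ (bdd S1 _) (abs_nonneg _) (bdd S2 _)
  set h := (fun p : ℝ × ℝ => HH s x p.1 * HH s y p.2) with hh
  set r := (√(n:ℝ))⁻¹ with hr
  have hr2 : r^2 = (n:ℝ)⁻¹ := by rw [hr, inv_pow, Real.sq_sqrt hn0.le]
  have main := main_ind (by positivity) hT hhc ⟨1, hhb⟩ r (by positivity) ((1:ℝ≥0)/(2*n))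
    (by rw [hr2]; push_cast; field_simp) n 0
  simp only [zero_add] at main
  have hvv : (n:ℝ≥0) * (1/(2*n)) = 1/2 := by
    have : (n:ℝ≥0) ≠ 0 := by positivity
    field_simp
  rw [hvv] at main
  have hSS := SS_cont r n
  have hXi : ∫ a, h a ∂(Measure.map (fun θ : ℝ => (lacunarySin n θ, lacunaryCos n θ))
          (volume.restrict (Set.Icc (0:ℝ) 1))) = ∫ θ in (0:ℝ)..1, h (SS r n θ) := by
    simp only [lac_eq]
    rw [integral_map (by fun_prop) hhc.aestronglyMeasurable, integral_Icc_eq_integral_Ioc,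
      ← intervalIntegral.integral_of_le zero_le_one, split8 _ (by fun_prop)]
    congr 1
    ext θ
    have : ∀ k : ℕ, h (SS r n (8 * ((θ + k)/8))) = h (SS r n θ) := by
      intro k; rw [mul_div_cancel₀ _ (by norm_num), SS_nat]
    simp only [hr] at this
    simp [this, hr]
  rw [hXi]
  refine main.trans ?_
  have hnr : (n:ℝ) * r^2 = 1 := by rw [hr2]; field_simp
  have hr0 : 0 ≤ r := by positivity
  have lhs : (n:ℝ) * (2 * (3 * 4^2 * q^3) * r^3 * (1 + c3)) = q^3 * r * (96 * (1 + c3)) := by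
    calc _ = (n * r^2) * (q^3 * r * (96 * (1 + c3))) := by ring
      _ = _ := by rw [hnr, one_mul]
  rw [lhs]
  have l1 : L ≤ 2 * √n := by
    have := Real.log_le_rpow_div hn0.le (show (0:ℝ) < 1/2 by norm_num)
    rw [← Real.sqrt_eq_rpow] at this
    linarith
  have l2 : L^2 ≤ 16 * √n := by
    have := Real.log_le_rpow_div hn0.le (show (0:ℝ) < 1/4 by norm_num)
    have e : ((n:ℝ)^(1/4:ℝ))^2 = √n := by
      rw [Real.sqrt_eq_rpow, ← Real.rpow_natCast, ← Real.rpow_mul hn0.le]; norm_num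
    rw [← e]
    have h4 : L ≤ 4 * (n:ℝ)^(1/4:ℝ) := by linarith
    nlinarith
  have hfin : q^3 * r ≤ 18 * L⁻¹ := by
    rw [← div_eq_mul_inv 18 L, le_div_iff₀ hL0]
    have hrr : r * √n = 1 := by rw [hr]; exact inv_mul_cancel₀ (by positivity)
    calc q^3 * r * L ≤ (1 + L) * r * L := by gcongr
      _ = r * (L + L^2) := by ring
      _ ≤ r * (18 * √n) := by gcongr; linarith
      _ = 18 := by rw [mul_left_comm, hrr]; norm_num
  calc _ ≤ 18 * L⁻¹ * (96 * (1 + c3)) := by gcongr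
    _ = _ := by ring
end
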